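/- arXiv:1304.5677 — 11 statements merged into one kernel-verified Lean document; each statement's English description precedes it below -/
import Mathlib

section
/- Let 0 < c1 < c2 and 0 < D < c1 + c2. Define f^opt = (0, D) if D ≤ c2 − √(c1·c2), and otherwise f^opt = ( ((D − c2)√c1 + c1√c2)/(√c1 + √c2), ((D − c1)√c2 + c2√c1)/(√c1 + √c2) ). Then f^opt is a feasible flow assignment with f^opt_1 < c1 and f^opt_2 < c2, and for every feasible flow assignment (f1, f2) with f1 < c1 and f2 < c2, the total cost satisfies C(f^opt) ≤ C(f1, f2), i.e. f^opt minimizes the total cost f1·ℓ1(f1) + f2·ℓ2(f2) subject to f1 + f2 = D, f1 ≥ 0, f2 ≥ 0. -/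
/-- The flow assignment `f^opt` (given by `(0, D)` if `D ≤ c2 - √(c1 c2)`, and by
`( ((D - c2)√c1 + c1 √c2)/(√c1 + √c2), ((D - c1)√c2 + c2 √c1)/(√c1 + √c2) )`
otherwise) is feasible with components strictly below the corresponding
capacities, and it minimizes the total cost `f1/(c1 - f1) + f2/(c2 - f2)` over
all feasible flow assignments. -/
theorem optimal_flow_minimizes_total_cost
    (c1 c2 D : ℝ) (hc1 : 0 < c1) (hc12 : c1 < c2)
    (hD : 0 < D) (hDlt : D < c1 + c2)
    (f1 f2 : ℝ)
    (hf1 : f1 = if D ≤ c2 - Real.sqrt (c1 * c2) then 0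
      else ((D - c2) * Real.sqrt c1 + c1 * Real.sqrt c2) / (Real.sqrt c1 + Real.sqrt c2))
    (hf2 : f2 = if D ≤ c2 - Real.sqrt (c1 * c2) then D
      else ((D - c1) * Real.sqrt c2 + c2 * Real.sqrt c1) / (Real.sqrt c1 + Real.sqrt c2)) :
    (0 ≤ f1 ∧ 0 ≤ f2 ∧ f1 + f2 = D ∧ f1 < c1 ∧ f2 < c2) ∧
    ∀ g1 g2 : ℝ, 0 ≤ g1 → 0 ≤ g2 → g1 + g2 = D → g1 < c1 → g2 < c2 →
      f1 / (c1 - f1) + f2 / (c2 - f2) ≤ g1 / (c1 - g1) + g2 / (c2 - g2) := by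
  obtain ⟨a, ha, rfl⟩ : ∃ a : ℝ, 0 < a ∧ c1 = a ^ 2 :=
    ⟨Real.sqrt c1, Real.sqrt_pos.2 hc1, (Real.sq_sqrt hc1.le).symm⟩
  obtain ⟨b, hb, rfl⟩ : ∃ b : ℝ, 0 < b ∧ c2 = b ^ 2 :=
    ⟨Real.sqrt c2, Real.sqrt_pos.2 (hc1.trans hc12), (Real.sq_sqrt (hc1.trans hc12).le).symm⟩
  have hab : a < b := lt_of_pow_lt_pow_left₀ 2 hb.le hc12
  have hs : Real.sqrt (a ^ 2 * b ^ 2) = a * b := by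
    rw [← mul_pow, Real.sqrt_sq (mul_pos ha hb).le]
  rw [hs, Real.sqrt_sq ha.le, Real.sqrt_sq hb.le] at hf1 hf2
  have hpab : 0 < a * b := mul_pos ha hb
  by_cases h : D ≤ b ^ 2 - a * b
  · rw [if_pos h] at hf1 hf2
    subst hf1 hf2
    refine ⟨⟨le_rfl, hD.le, by ring, hc1, by linarith⟩, ?_⟩
    intro g1 g2 h1 h2 hg hg1 hg2
    have hx : 0 < a ^ 2 - g1 := by linarith
    have hy : 0 < b ^ 2 - g2 := by linarith
    have hy0 : a * b ≤ b ^ 2 - f2 := by linarith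
    have hy0' : 0 < b ^ 2 - f2 := by linarith
    have hyy : b ^ 2 - f2 ≤ b ^ 2 - g2 := by linarith
    have key : b ^ 2 * (a ^ 2 - g1) ≤ (b ^ 2 - f2) * (b ^ 2 - g2) := by
      have h3 : (a * b) * (a * b) ≤ (b ^ 2 - f2) * (b ^ 2 - g2) :=
        mul_le_mul hy0 (hy0.trans hyy) hpab.le hy0'.le
      have h4 : 0 ≤ b ^ 2 * g1 := by positivity
      nlinarith
    have e : g1 / (a ^ 2 - g1) + g2 / (b ^ 2 - g2) - (0 / (a ^ 2 - 0) + f2 / (b ^ 2 - f2))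
        = g1 * ((b ^ 2 - f2) * (b ^ 2 - g2) - b ^ 2 * (a ^ 2 - g1)) /
          ((a ^ 2 - g1) * ((b ^ 2 - f2) * (b ^ 2 - g2))) := by
      subst hg
      field_simp
      ring
    have : 0 ≤ g1 * ((b ^ 2 - f2) * (b ^ 2 - g2) - b ^ 2 * (a ^ 2 - g1)) /
          ((a ^ 2 - g1) * ((b ^ 2 - f2) * (b ^ 2 - g2))) := by
      apply div_nonneg
      · exact mul_nonneg h1 (by linarith)
      · positivity
    linarith
  · rw [if_neg h] at hf1 hf2
    push Not at h
    have hS : 0 < a ^ 2 + b ^ 2 - D := by linarith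
    have hsum : 0 < a + b := by linarith
    have e1 : a ^ 2 - f1 = a * (a ^ 2 + b ^ 2 - D) / (a + b) := by
      rw [hf1]; field_simp; ring
    have e2 : b ^ 2 - f2 = b * (a ^ 2 + b ^ 2 - D) / (a + b) := by
      rw [hf2]; field_simp; ring
    have p1 : 0 < a ^ 2 - f1 := by rw [e1]; positivity
    have p2 : 0 < b ^ 2 - f2 := by rw [e2]; positivity
    refine ⟨⟨?_, ?_, ?_, by linarith, by linarith⟩, ?_⟩
    · rw [hf1]
      apply div_nonneg _ hsum.le
      nlinarith [mul_pos ha (sub_pos.2 h)]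
    · rw [hf2]
      apply div_nonneg _ hsum.le
      nlinarith [mul_pos hb (sub_pos.2 h), mul_pos hb (mul_pos (sub_pos.2 hab) (sub_pos.2 hab)),
        mul_pos hb hD, mul_pos hb (mul_pos ha (sub_pos.2 hab))]
    · rw [hf1, hf2]; field_simp; ring
    intro g1 g2 h1 h2 hg hg1 hg2
    have hx : 0 < a ^ 2 - g1 := by linarith
    have hy : 0 < b ^ 2 - g2 := by linarith
    have c1 : f1 / (a ^ 2 - f1) = a * (a + b) / (a ^ 2 + b ^ 2 - D) - 1 := by
      have : f1 = a ^ 2 - (a ^ 2 - f1) := by ring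
      rw [show f1 / (a ^ 2 - f1) = a ^ 2 / (a ^ 2 - f1) - 1 by field_simp; ring, e1]
      field_simp
    have c2 : f2 / (b ^ 2 - f2) = b * (a + b) / (a ^ 2 + b ^ 2 - D) - 1 := by
      rw [show f2 / (b ^ 2 - f2) = b ^ 2 / (b ^ 2 - f2) - 1 by field_simp; ring, e2]
      field_simp
    have d1 : g1 / (a ^ 2 - g1) = a ^ 2 / (a ^ 2 - g1) - 1 := by field_simp; ring
    have d2 : g2 / (b ^ 2 - g2) = b ^ 2 / (b ^ 2 - g2) - 1 := by field_simp; ring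
    rw [c1, c2, d1, d2]
    have hSe : a ^ 2 + b ^ 2 - D = (a ^ 2 - g1) + (b ^ 2 - g2) := by linarith
    rw [hSe]
    generalize a ^ 2 - g1 = x at *
    generalize b ^ 2 - g2 = y at *
    have e : a ^ 2 / x + b ^ 2 / y - (a * (a + b) / (x + y) + b * (a + b) / (x + y))
        = (a * y - b * x) ^ 2 / (x * y * (x + y)) := by
      field_simp
      ring
    have : 0 ≤ (a * y - b * x) ^ 2 / (x * y * (x + y)) := by positivity
    linarith
end

section
/- Let 0 < c1 < c2 and 0 < D < c1 + c2. The minimizer of the total cost over feasible flow assignments is unique: if (f1, f2) and (g1, g2) are both feasible flow assignments with all components strictly below the corresponding capacities, and both attain the minimum of C(f1, f2) = f1/(c1 − f1) + f2/(c2 − f2) over such assignments, then (f1, f2) = (g1, g2). -/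
theorem midpoint_gap (c x y : ℝ) (hx : x < c) (hy : y < c) :
    x / (c - x) + y / (c - y) - 2 * (((x + y) / 2) / (c - (x + y) / 2))
      = c * (x - y) ^ 2 / ((c - x) * (c - y) * ((c - x) + (c - y))) := by
  have h1 : c - x ≠ 0 := (sub_pos.2 hx).ne'
  have h2 : c - y ≠ 0 := (sub_pos.2 hy).ne'
  have h3 : (c - x) + (c - y) ≠ 0 := (add_pos (sub_pos.2 hx) (sub_pos.2 hy)).ne'
  have h4 : c - (x + y) / 2 = ((c - x) + (c - y)) / 2 := by ring
  rw [h4]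
  field_simp
  ring

/-- Uniqueness of the total-cost minimizer: if two feasible flow assignments
(nonnegative, summing to `D`, with components strictly below the
corresponding capacities) both attain the minimum of the total cost
`f1/(c1 - f1) + f2/(c2 - f2)` over all such assignments, then they coincide. -/
theorem optimal_flow_unique
    (c1 c2 D : ℝ) (hc1 : 0 < c1) (hc12 : c1 < c2)
    (hD : 0 < D) (hDlt : D < c1 + c2)
    (f1 f2 g1 g2 : ℝ)
    (hf1 : 0 ≤ f1) (hf2 : 0 ≤ f2) (hfsum : f1 + f2 = D) (hf1c : f1 < c1) (hf2c : f2 < c2)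
    (hg1 : 0 ≤ g1) (hg2 : 0 ≤ g2) (hgsum : g1 + g2 = D) (hg1c : g1 < c1) (hg2c : g2 < c2)
    (hfmin : ∀ h1 h2 : ℝ, 0 ≤ h1 → 0 ≤ h2 → h1 + h2 = D → h1 < c1 → h2 < c2 →
      f1 / (c1 - f1) + f2 / (c2 - f2) ≤ h1 / (c1 - h1) + h2 / (c2 - h2))
    (hgmin : ∀ h1 h2 : ℝ, 0 ≤ h1 → 0 ≤ h2 → h1 + h2 = D → h1 < c1 → h2 < c2 →
      g1 / (c1 - g1) + g2 / (c2 - g2) ≤ h1 / (c1 - h1) + h2 / (c2 - h2)) :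
    f1 = g1 ∧ f2 = g2 := by
  have hfg : f1 = g1 := by
    by_contra hne
    have k1 := midpoint_gap c1 f1 g1 hf1c hg1c
    have k2 := midpoint_gap c2 f2 g2 hf2c hg2c
    have a1 := sub_pos.2 hf1c
    have a2 := sub_pos.2 hf2c
    have b1 := sub_pos.2 hg1c
    have b2 := sub_pos.2 hg2c
    have hc2 : 0 < c2 := hc1.trans hc12
    have hs : 0 < (f1 - g1) ^ 2 := by
      have := sub_ne_zero.2 hne
      positivity
    have p1 : 0 < c1 * (f1 - g1) ^ 2 / ((c1 - f1) * (c1 - g1) * ((c1 - f1) + (c1 - g1))) := by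
      positivity
    have p2 : 0 ≤ c2 * (f2 - g2) ^ 2 / ((c2 - f2) * (c2 - g2) * ((c2 - f2) + (c2 - g2))) := by
      positivity
    have m1 := hfmin ((f1 + g1) / 2) ((f2 + g2) / 2) (by linarith) (by linarith) (by linarith)
      (by linarith) (by linarith)
    have m2 := hgmin ((f1 + g1) / 2) ((f2 + g2) / 2) (by linarith) (by linarith) (by linarith)
      (by linarith) (by linarith)
    linarith
  exact ⟨hfg, by linarith⟩
end

section
/- Let 0 < c1 < c2 and 0 < D < c1 + c2. Let f^WE_2 = D if D ≤ c2 − c1 and f^WE_2 = (D + c2 − c1)/2 otherwise; let f^opt_2 = D if D ≤ c2 − √(c1·c2) and f^opt_2 = ((D − c1)√c2 + c2√c1)/(√c1 + √c2) otherwise. Then f^opt_2 ≤ f^WE_2: the flow routed through the largest-capacity network at the Wardrop equilibrium is greater than or equal to the flow routed through it at the optimum. -/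
/-- The flow routed through the largest-capacity network (network 2) at the
Wardrop equilibrium is greater than or equal to the flow routed through it
at the total-cost optimum: `f^opt_2 ≤ f^WE_2`. -/
theorem optimal_flow_le_equilibrium_flow_on_network_two
    (c1 c2 D : ℝ) (hc1 : 0 < c1) (hc12 : c1 < c2)
    (hD : 0 < D) (hDlt : D < c1 + c2)
    (fWE2 fopt2 : ℝ)
    (hWE2 : fWE2 = if D ≤ c2 - c1 then D else (D + c2 - c1) / 2)
    (hopt2 : fopt2 = if D ≤ c2 - Real.sqrt (c1 * c2) then D
      else ((D - c1) * Real.sqrt c2 + c2 * Real.sqrt c1) / (Real.sqrt c1 + Real.sqrt c2)) :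
    fopt2 ≤ fWE2 := by
  have hc2 : 0 < c2 := hc1.trans hc12
  obtain ⟨a, ha⟩ : ∃ a, a = Real.sqrt c1 := ⟨_, rfl⟩
  obtain ⟨b, hb⟩ : ∃ b, b = Real.sqrt c2 := ⟨_, rfl⟩
  have ha0 : 0 < a := ha ▸ Real.sqrt_pos.2 hc1
  have hab : a < b := by
    rw [ha, hb]
    exact Real.sqrt_lt_sqrt hc1.le hc12
  have h1 : c1 = a * a := by rw [ha, Real.mul_self_sqrt hc1.le]
  have h2 : c2 = b * b := by rw [hb, Real.mul_self_sqrt hc2.le]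
  rw [Real.sqrt_mul hc1.le, ← ha, ← hb] at hopt2
  clear ha hb
  subst h1 h2
  have hs : 0 < a + b := by linarith
  rw [hWE2, hopt2]
  split_ifs with h h' h'
  · exact le_rfl
  · exfalso
    nlinarith [mul_pos ha0 (sub_pos.2 hab)]
  · rw [div_le_iff₀ hs]
    push Not at h
    nlinarith [mul_pos ha0 (sub_pos.2 h)]
  · rw [div_le_iff₀ hs]
    nlinarith [mul_pos (sub_pos.2 hab) (sub_pos.2 hDlt)]
end

section
/- Let 0 < c1 < c2 and 0 < D < c1 + c2. If D ≤ c2 − √(c1·c2), then the Wardrop equilibrium without taxes coincides with the optimal flow assignment: f^WE = f^opt = (0, D); hence the total cost is minimized at equilibrium and no tax is necessary. -/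
/-- When `D ≤ c2 - √(c1 c2)`, the Wardrop equilibrium without taxes coincides
with the optimal flow assignment: `f^WE = f^opt = (0, D)`, and hence the total
cost is minimized at equilibrium (no tax is necessary). -/
theorem equilibrium_optimal_when_low_demand
    (c1 c2 D : ℝ) (hc1 : 0 < c1) (hc12 : c1 < c2)
    (hD : 0 < D) (hDlt : D < c1 + c2)
    (hlow : D ≤ c2 - Real.sqrt (c1 * c2))
    (fWE1 fWE2 : ℝ)
    (hWE1 : fWE1 = if D ≤ c2 - c1 then 0 else (D + c1 - c2) / 2)
    (hWE2 : fWE2 = if D ≤ c2 - c1 then D else (D + c2 - c1) / 2) :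
    fWE1 = 0 ∧ fWE2 = D ∧
    ∀ g1 g2 : ℝ, 0 ≤ g1 → 0 ≤ g2 → g1 + g2 = D → g1 < c1 → g2 < c2 →
      fWE1 / (c1 - fWE1) + fWE2 / (c2 - fWE2) ≤ g1 / (c1 - g1) + g2 / (c2 - g2) := by
  have hc2 : 0 < c2 := hc1.trans hc12
  have hs1 : c1 < Real.sqrt (c1 * c2) := by
    apply Real.lt_sqrt_of_sq_lt
    nlinarith
  have hs2 : Real.sqrt (c1 * c2) ^ 2 = c1 * c2 := Real.sq_sqrt (by positivity)
  have hle : D ≤ c2 - c1 := by linarith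
  rw [if_pos hle] at hWE1 hWE2
  subst hWE1 hWE2
  refine ⟨rfl, rfl, ?_⟩
  intro x y hx hy hxy hx1 hy2
  have hE : 0 < c2 - fWE2 := by linarith
  have hE2 : c1 * c2 ≤ (c2 - fWE2) ^ 2 := by
    rw [← hs2]
    exact pow_le_pow_left₀ (Real.sqrt_nonneg _) (by linarith) 2
  have hY : 0 < c2 - y := by linarith
  have hX : 0 < c1 - x := by linarith
  have key : fWE2 / (c2 - fWE2) - y / (c2 - y) = x * c2 / ((c2 - fWE2) * (c2 - y)) := by
    rw [div_sub_div _ _ hE.ne' hY.ne']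
    congr 1
    rw [← hxy]; ring
  have h2 : x * c2 / ((c2 - fWE2) * (c2 - y)) ≤ x / (c1 - x) := by
    rw [div_le_div_iff₀ (mul_pos hE hY) hX, mul_assoc]
    apply mul_le_mul_of_nonneg_left _ hx
    have hy' : c2 - y = (c2 - fWE2) + x := by linarith
    rw [hy']
    nlinarith [mul_nonneg hE.le hx, mul_nonneg hc2.le hx]
  rw [zero_div, zero_add]
  linarith
end

section
/- Let 0 < c1 < c2 and c2 − √(c1·c2) < D < c1 + c2, and let f^opt_1 = ((D − c2)√c1 + c1√c2)/(√c1 + √c2) and f^opt_2 = ((D − c1)√c2 + c2√c1)/(√c1 + √c2). Then 0 < f^opt_1 < c1 and 0 < f^opt_2 < c2; in particular both networks carry strictly positive flow at the optimum and both latencies are finite. -/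
/-- In the high-demand regime `c2 - √(c1 c2) < D < c1 + c2`, both components of
the optimal flow assignment are strictly positive and strictly below the
corresponding capacities: `0 < f^opt_1 < c1` and `0 < f^opt_2 < c2`. -/
theorem optimal_flow_interior_when_high_demand
    (c1 c2 D : ℝ) (hc1 : 0 < c1) (hc12 : c1 < c2)
    (hDgt : c2 - Real.sqrt (c1 * c2) < D) (hDlt : D < c1 + c2)
    (f1 f2 : ℝ)
    (hf1 : f1 = ((D - c2) * Real.sqrt c1 + c1 * Real.sqrt c2) / (Real.sqrt c1 + Real.sqrt c2))
    (hf2 : f2 = ((D - c1) * Real.sqrt c2 + c2 * Real.sqrt c1) / (Real.sqrt c1 + Real.sqrt c2)) :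
    0 < f1 ∧ f1 < c1 ∧ 0 < f2 ∧ f2 < c2 := by
  have hc2 : 0 < c2 := hc1.trans hc12
  have ha : 0 < Real.sqrt c1 := Real.sqrt_pos.2 hc1
  have hb : 0 < Real.sqrt c2 := Real.sqrt_pos.2 hc2
  have ha2 : Real.sqrt c1 * Real.sqrt c1 = c1 := Real.mul_self_sqrt hc1.le
  have hb2 : Real.sqrt c2 * Real.sqrt c2 = c2 := Real.mul_self_sqrt hc2.le
  rw [Real.sqrt_mul hc1.le] at hDgt
  subst hf1 hf2
  generalize Real.sqrt c1 = a at *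
  generalize Real.sqrt c2 = b at *
  have hs : 0 < a + b := add_pos ha hb
  subst ha2 hb2
  refine ⟨div_pos ?_ hs, (div_lt_iff₀ hs).2 ?_, div_pos ?_ hs, (div_lt_iff₀ hs).2 ?_⟩
  · have := mul_pos ha (sub_pos.2 hDgt)
    linarith
  · have := mul_pos ha (sub_pos.2 hDlt)
    linarith
  · have := mul_pos hb (sub_pos.2 hDgt)
    have := mul_pos hb (sub_pos.2 hc12)
    have := mul_pos hb (mul_pos ha hb)
    linarith
  · have := mul_pos hb (sub_pos.2 hDlt)
    linarith
end

section
/- Let 0 < c1 < c2 and c2 − √(c1·c2) < D < c1 + c2, and let f^opt_1 = ((D − c2)√c1 + c1√c2)/(√c1 + √c2) and f^opt_2 = ((D − c1)√c2 + c2√c1)/(√c1 + √c2). Then the latency gap at the optimum satisfies the identity ℓ1(f^opt_1) − ℓ2(f^opt_2) = 1/(c1 − f^opt_1) − 1/(c2 − f^opt_2) = (c2 − c1)/( √(c1·c2) · (c1 + c2 − D) ). -/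
/-- In the high-demand regime `c2 - √(c1 c2) < D < c1 + c2`, the latency gap at
the optimal flow assignment satisfies
`ℓ1(f^opt_1) - ℓ2(f^opt_2) = (c2 - c1) / (√(c1 c2) (c1 + c2 - D))`. -/
theorem optimal_flow_latency_gap
    (c1 c2 D : ℝ) (hc1 : 0 < c1) (hc12 : c1 < c2)
    (hDgt : c2 - Real.sqrt (c1 * c2) < D) (hDlt : D < c1 + c2)
    (f1 f2 : ℝ)
    (hf1 : f1 = ((D - c2) * Real.sqrt c1 + c1 * Real.sqrt c2) / (Real.sqrt c1 + Real.sqrt c2))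
    (hf2 : f2 = ((D - c1) * Real.sqrt c2 + c2 * Real.sqrt c1) / (Real.sqrt c1 + Real.sqrt c2)) :
    1 / (c1 - f1) - 1 / (c2 - f2) =
      (c2 - c1) / (Real.sqrt (c1 * c2) * (c1 + c2 - D)) := by
  have hc2 : 0 < c2 := hc1.trans hc12
  have ha : 0 < Real.sqrt c1 := Real.sqrt_pos.mpr hc1
  have hb : 0 < Real.sqrt c2 := Real.sqrt_pos.mpr hc2
  have ha2 : Real.sqrt c1 ^ 2 = c1 := Real.sq_sqrt hc1.le
  have hb2 : Real.sqrt c2 ^ 2 = c2 := Real.sq_sqrt hc2.le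
  have hS : 0 < c1 + c2 - D := by linarith
  rw [Real.sqrt_mul hc1.le]
  generalize Real.sqrt c1 = a at *
  generalize Real.sqrt c2 = b at *
  have hab : a + b ≠ 0 := by positivity
  have h1 : c1 - f1 = a * (c1 + c2 - D) / (a + b) := by
    rw [hf1, eq_div_iff hab, sub_mul, div_mul_cancel₀ _ hab]; ring
  have h2 : c2 - f2 = b * (c1 + c2 - D) / (a + b) := by
    rw [hf2, eq_div_iff hab, sub_mul, div_mul_cancel₀ _ hab]; ring
  have h3 : c2 - c1 = (a + b) * (b - a) := by rw [← ha2, ← hb2]; ring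
  rw [h1, h2, h3]
  generalize c1 + c2 - D = S at *
  have hS0 := hS.ne'
  have ha0 := ha.ne'
  have hb0 := hb.ne'
  field_simp
end

section
/- Let 0 < c1 < c2, αA > αB > 0, demands dA, dB > 0 with D = dA + dB satisfying c2 − √(c1·c2) < D < c1 + c2, and let f^opt_1 = ((D − c2)√c1 + c1√c2)/(√c1 + √c2), f^opt_2 = ((D − c1)√c2 + c2√c1)/(√c1 + √c2). Suppose dB ≤ f^opt_2 and set τ1 = 0 and τ2 = (c2 − c1)/( αA·√(c1·c2)·(c1 + c2 − D) ). Then every taxed Wardrop equilibrium (f_{1,A}, f_{2,A}, f_{1,B}, f_{2,B}) with aggregate flows f_p = f_{p,A} + f_{p,B} < c_p has f_1 = f^opt_1 and f_2 = f^opt_2: the tax drives the selfish equilibrium to the cost-minimizing flow assignment. -/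
/-- When `dB ≤ f^opt_2` and the tax `τ2 = (c2 - c1)/(αA √(c1 c2) (c1 + c2 - D))`
is applied to network 2 (with `τ1 = 0`), every taxed Wardrop equilibrium has
aggregate flows equal to the total-cost-minimizing flow assignment
`(f^opt_1, f^opt_2)`. -/
theorem optimal_tax_drives_equilibrium_to_optimum_case_A
    (c1 c2 dA dB D αA αB τ1 τ2 fopt1 fopt2 : ℝ)
    (hc1 : 0 < c1) (hc12 : c1 < c2)
    (hdA : 0 < dA) (hdB : 0 < dB) (hD : D = dA + dB)
    (hDgt : c2 - Real.sqrt (c1 * c2) < D) (hDlt : D < c1 + c2)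
    (hαB : 0 < αB) (hαAB : αB < αA)
    (hopt1 : fopt1 = ((D - c2) * Real.sqrt c1 + c1 * Real.sqrt c2) / (Real.sqrt c1 + Real.sqrt c2))
    (hopt2 : fopt2 = ((D - c1) * Real.sqrt c2 + c2 * Real.sqrt c1) / (Real.sqrt c1 + Real.sqrt c2))
    (hdBle : dB ≤ fopt2)
    (hτ1 : τ1 = 0)
    (hτ2 : τ2 = (c2 - c1) / (αA * Real.sqrt (c1 * c2) * (c1 + c2 - D)))
    (f1A f2A f1B f2B : ℝ)
    (hf1A : 0 ≤ f1A) (hf2A : 0 ≤ f2A) (hf1B : 0 ≤ f1B) (hf2B : 0 ≤ f2B)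
    (hsumA : f1A + f2A = dA) (hsumB : f1B + f2B = dB)
    (hcap1 : f1A + f1B < c1) (hcap2 : f2A + f2B < c2)
    (hW1A : 0 < f1A →
      1 / (c1 - (f1A + f1B)) + αA * τ1 ≤ 1 / (c2 - (f2A + f2B)) + αA * τ2)
    (hW2A : 0 < f2A →
      1 / (c2 - (f2A + f2B)) + αA * τ2 ≤ 1 / (c1 - (f1A + f1B)) + αA * τ1)
    (hW1B : 0 < f1B →
      1 / (c1 - (f1A + f1B)) + αB * τ1 ≤ 1 / (c2 - (f2A + f2B)) + αB * τ2)
    (hW2B : 0 < f2B →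
      1 / (c2 - (f2A + f2B)) + αB * τ2 ≤ 1 / (c1 - (f1A + f1B)) + αB * τ1) :
    f1A + f1B = fopt1 ∧ f2A + f2B = fopt2 := by
  have hc2 : 0 < c2 := hc1.trans hc12
  have hαA : 0 < αA := hαB.trans hαAB
  have hst : Real.sqrt (c1 * c2) = Real.sqrt c1 * Real.sqrt c2 := Real.sqrt_mul hc1.le c2
  have hs : 0 < Real.sqrt c1 := Real.sqrt_pos.mpr hc1
  have ht : 0 < Real.sqrt c2 := Real.sqrt_pos.mpr hc2
  have hs2 : c1 = Real.sqrt c1 ^ 2 := (Real.sq_sqrt hc1.le).symm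
  have ht2 : c2 = Real.sqrt c2 ^ 2 := (Real.sq_sqrt hc2.le).symm
  rw [hst] at hDgt hτ2
  generalize Real.sqrt c1 = s at *
  generalize Real.sqrt c2 = t at *
  have hS : 0 < c1 + c2 - D := by linarith
  have hsum : fopt1 + fopt2 = D := by
    rw [hopt1, hopt2]; field_simp; ring
  have e1 : c1 - fopt1 = s * (c1 + c2 - D) / (s + t) := by
    rw [hopt1]; field_simp; ring
  have e2 : c2 - fopt2 = t * (c1 + c2 - D) / (s + t) := by
    rw [hopt2]; field_simp; ring
  have p1 : 0 < c1 - fopt1 := by rw [e1]; positivity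
  have p2 : 0 < c2 - fopt2 := by rw [e2]; positivity
  have hT : αA * τ2 = 1 / (c1 - fopt1) - 1 / (c2 - fopt2) := by
    rw [e1, e2, hτ2]
    generalize c1 + c2 - D = S at *
    rw [hs2, ht2]
    field_simp
    ring
  have hτpos : 0 < τ2 := by
    rw [hτ2]
    have : 0 < c2 - c1 := by linarith
    positivity
  have hαlt : αB * τ2 < αA * τ2 := mul_lt_mul_of_pos_right hαAB hτpos
  have hf1pos : 0 < fopt1 := by
    rw [hopt1]
    apply div_pos _ (by positivity)
    have h := mul_pos (show 0 < D - c2 + s * t by linarith) hs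
    have h2 : c1 * t = s ^ 2 * t := by rw [← hs2]
    nlinarith
  subst hτ1
  simp only [mul_zero, add_zero] at hW1A hW2A hW1B hW2B
  have key : f1A + f1B = fopt1 := by
    rcases lt_trichotomy (f1A + f1B) fopt1 with h | h | h
    · have hpos : 0 < f2A := by linarith
      have a := hW2A hpos
      have b : 1 / (c1 - (f1A + f1B)) < 1 / (c1 - fopt1) :=
        one_div_lt_one_div_of_lt p1 (by linarith)
      have c : 1 / (c2 - fopt2) < 1 / (c2 - (f2A + f2B)) :=
        one_div_lt_one_div_of_lt (by linarith) (by linarith)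
      linarith
    · exact h
    · have b : 1 / (c1 - fopt1) < 1 / (c1 - (f1A + f1B)) :=
        one_div_lt_one_div_of_lt (by linarith) (by linarith)
      have c : 1 / (c2 - (f2A + f2B)) < 1 / (c2 - fopt2) :=
        one_div_lt_one_div_of_lt p2 (by linarith)
      rcases hf1A.lt_or_eq with ha | ha
      · have a := hW1A ha
        linarith
      · have a := hW1B (by linarith)
        linarith
  exact ⟨key, by linarith⟩
end

section
/- Let 0 < c1 < c2, αA > αB > 0, demands dA, dB > 0 with D = dA + dB satisfying c2 − √(c1·c2) < D < c1 + c2, and let f^opt_1 = ((D − c2)√c1 + c1√c2)/(√c1 + √c2), f^opt_2 = ((D − c1)√c2 + c2√c1)/(√c1 + √c2). Suppose dB > f^opt_2 and set τ1 = 0 and τ2 = (c2 − c1)/( αB·√(c1·c2)·(c1 + c2 − D) ). Then every taxed Wardrop equilibrium (f_{1,A}, f_{2,A}, f_{1,B}, f_{2,B}) with aggregate flows f_p = f_{p,A} + f_{p,B} < c_p has f_1 = f^opt_1 and f_2 = f^opt_2: the tax drives the selfish equilibrium to the cost-minimizing flow assignment. -/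
/-- When `dB > f^opt_2` and the tax `τ2 = (c2 - c1)/(αB √(c1 c2) (c1 + c2 - D))`
is applied to network 2 (with `τ1 = 0`), every taxed Wardrop equilibrium has
aggregate flows equal to the total-cost-minimizing flow assignment
`(f^opt_1, f^opt_2)`. -/
theorem optimal_tax_drives_equilibrium_to_optimum_case_B
    (c1 c2 dA dB D αA αB τ1 τ2 fopt1 fopt2 : ℝ)
    (hc1 : 0 < c1) (hc12 : c1 < c2)
    (hdA : 0 < dA) (hdB : 0 < dB) (hD : D = dA + dB)
    (hDgt : c2 - Real.sqrt (c1 * c2) < D) (hDlt : D < c1 + c2)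
    (hαB : 0 < αB) (hαAB : αB < αA)
    (hopt1 : fopt1 = ((D - c2) * Real.sqrt c1 + c1 * Real.sqrt c2) / (Real.sqrt c1 + Real.sqrt c2))
    (hopt2 : fopt2 = ((D - c1) * Real.sqrt c2 + c2 * Real.sqrt c1) / (Real.sqrt c1 + Real.sqrt c2))
    (hdBgt : fopt2 < dB)
    (hτ1 : τ1 = 0)
    (hτ2 : τ2 = (c2 - c1) / (αB * Real.sqrt (c1 * c2) * (c1 + c2 - D)))
    (f1A f2A f1B f2B : ℝ)
    (hf1A : 0 ≤ f1A) (hf2A : 0 ≤ f2A) (hf1B : 0 ≤ f1B) (hf2B : 0 ≤ f2B)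
    (hsumA : f1A + f2A = dA) (hsumB : f1B + f2B = dB)
    (hcap1 : f1A + f1B < c1) (hcap2 : f2A + f2B < c2)
    (hW1A : 0 < f1A →
      1 / (c1 - (f1A + f1B)) + αA * τ1 ≤ 1 / (c2 - (f2A + f2B)) + αA * τ2)
    (hW2A : 0 < f2A →
      1 / (c2 - (f2A + f2B)) + αA * τ2 ≤ 1 / (c1 - (f1A + f1B)) + αA * τ1)
    (hW1B : 0 < f1B →
      1 / (c1 - (f1A + f1B)) + αB * τ1 ≤ 1 / (c2 - (f2A + f2B)) + αB * τ2)
    (hW2B : 0 < f2B →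
      1 / (c2 - (f2A + f2B)) + αB * τ2 ≤ 1 / (c1 - (f1A + f1B)) + αB * τ1) :
    f1A + f1B = fopt1 ∧ f2A + f2B = fopt2 := by
  have hc2 : 0 < c2 := hc1.trans hc12
  rw [Real.sqrt_mul hc1.le] at hDgt hτ2
  obtain ⟨s, hs⟩ : ∃ s, s = Real.sqrt c1 := ⟨_, rfl⟩
  obtain ⟨t, ht⟩ : ∃ t, t = Real.sqrt c2 := ⟨_, rfl⟩
  have hs0 : 0 < s := by rw [hs]; exact Real.sqrt_pos.2 hc1
  have ht0 : 0 < t := by rw [ht]; exact Real.sqrt_pos.2 hc2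
  have hs2 : c1 = s ^ 2 := by rw [hs, Real.sq_sqrt hc1.le]
  have ht2 : c2 = t ^ 2 := by rw [ht, Real.sq_sqrt hc2.le]
  rw [← hs, ← ht] at hDgt hτ2 hopt1 hopt2
  have hR : 0 < c1 + c2 - D := by linarith
  obtain ⟨R, hRd⟩ : ∃ R, R = c1 + c2 - D := ⟨_, rfl⟩
  rw [← hRd] at hR hτ2
  have hst : 0 < s + t := by linarith
  have e1 : c1 - fopt1 = s * R / (s + t) := by
    rw [hopt1, hRd, hs2, ht2]; field_simp; ring
  have e2 : c2 - fopt2 = t * R / (s + t) := by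
    rw [hopt2, hRd, hs2, ht2]; field_simp; ring
  have hsum : fopt1 + fopt2 = D := by
    have h : s * R / (s + t) + t * R / (s + t) = R := by field_simp
    linarith
  have p1 : 0 < c1 - fopt1 := by rw [e1]; positivity
  have p2 : 0 < c2 - fopt2 := by rw [e2]; positivity
  have hτeq : 1 / (c1 - fopt1) = 1 / (c2 - fopt2) + αB * τ2 := by
    rw [e1, e2, hτ2, hs2, ht2]; field_simp; ring
  have hτpos : 0 < τ2 := by
    rw [hτ2]
    have : 0 < c2 - c1 := by linarith
    positivity
  have hατ : αB * τ2 < αA * τ2 := mul_lt_mul_of_pos_right hαAB hτpos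
  have hfo2 : 0 < fopt2 := by
    rw [hopt2]
    apply div_pos _ hst
    have h : (D - c1) * t + c2 * s = t * (D - c1 + t * s) := by rw [ht2]; ring
    rw [h]
    apply mul_pos ht0
    nlinarith
  have key : f2A + f2B = fopt2 := by
    rcases lt_trichotomy (f2A + f2B) fopt2 with h | h | h
    · exfalso
      have l1 : 1 / (c1 - fopt1) < 1 / (c1 - (f1A + f1B)) :=
        one_div_lt_one_div_of_lt (by linarith) (by linarith)
      have l2 : 1 / (c2 - (f2A + f2B)) < 1 / (c2 - fopt2) :=
        one_div_lt_one_div_of_lt p2 (by linarith)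
      have h1 : 0 < f1B := by linarith
      have := hW1B h1
      rw [hτ1] at this
      linarith
    · exact h
    · exfalso
      have l1 : 1 / (c1 - (f1A + f1B)) < 1 / (c1 - fopt1) :=
        one_div_lt_one_div_of_lt p1 (by linarith)
      have l2 : 1 / (c2 - fopt2) < 1 / (c2 - (f2A + f2B)) :=
        one_div_lt_one_div_of_lt (by linarith) (by linarith)
      rw [hτ1] at hW2A hW2B
      rcases hf2A.lt_or_eq with h1 | h1
      · have := hW2A h1
        linarith
      · have := hW2B (by linarith)
        linarith
  exact ⟨by linarith, key⟩
end

section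
/- Let 0 < c1 < c2, αA > αB > 0, demands dA, dB > 0 with D = dA + dB satisfying c2 − √(c1·c2) < D < c1 + c2, and let f^opt_1 = ((D − c2)√c1 + c1√c2)/(√c1 + √c2), f^opt_2 = ((D − c1)√c2 + c2√c1)/(√c1 + √c2). Suppose dB ≤ f^opt_2, and set τ1 = 0 and τ2 = (c2 − c1)/( αA·√(c1·c2)·(c1 + c2 − D) ). Then the class-decomposed flow defined by f_{1,B} = 0, f_{2,B} = dB, f_{1,A} = f^opt_1, f_{2,A} = dA − f^opt_1 is well defined (all components nonnegative, satisfying the class demand constraints) and is a taxed Wardrop equilibrium whose aggregate flows are exactly (f^opt_1, f^opt_2). -/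
/-- When `dB ≤ f^opt_2` and the tax `τ2 = (c2 - c1)/(αA √(c1 c2) (c1 + c2 - D))`
is applied to network 2 (with `τ1 = 0`), the class-decomposed flow
`f_{1,B} = 0`, `f_{2,B} = dB`, `f_{1,A} = f^opt_1`, `f_{2,A} = dA - f^opt_1`
is well defined (all components nonnegative, satisfying the class demand
constraints) and is a taxed Wardrop equilibrium with aggregate flows
`(f^opt_1, f^opt_2)`. -/
theorem optimal_tax_equilibrium_exists_case_A
    (c1 c2 dA dB D αA αB τ1 τ2 fopt1 fopt2 : ℝ)
    (hc1 : 0 < c1) (hc12 : c1 < c2)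
    (hdA : 0 < dA) (hdB : 0 < dB) (hD : D = dA + dB)
    (hDgt : c2 - Real.sqrt (c1 * c2) < D) (hDlt : D < c1 + c2)
    (hαB : 0 < αB) (hαAB : αB < αA)
    (hopt1 : fopt1 = ((D - c2) * Real.sqrt c1 + c1 * Real.sqrt c2) / (Real.sqrt c1 + Real.sqrt c2))
    (hopt2 : fopt2 = ((D - c1) * Real.sqrt c2 + c2 * Real.sqrt c1) / (Real.sqrt c1 + Real.sqrt c2))
    (hdBle : dB ≤ fopt2)
    (hτ1 : τ1 = 0)
    (hτ2 : τ2 = (c2 - c1) / (αA * Real.sqrt (c1 * c2) * (c1 + c2 - D)))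
    (f1A f2A f1B f2B : ℝ)
    (hf1B : f1B = 0) (hf2B : f2B = dB)
    (hf1A : f1A = fopt1) (hf2A : f2A = dA - fopt1) :
    (0 ≤ f1A ∧ 0 ≤ f2A ∧ 0 ≤ f1B ∧ 0 ≤ f2B ∧
      f1A + f2A = dA ∧ f1B + f2B = dB) ∧
    (f1A + f1B = fopt1 ∧ f2A + f2B = fopt2) ∧
    (0 < f1A →
      1 / (c1 - (f1A + f1B)) + αA * τ1 ≤ 1 / (c2 - (f2A + f2B)) + αA * τ2) ∧
    (0 < f2A →
      1 / (c2 - (f2A + f2B)) + αA * τ2 ≤ 1 / (c1 - (f1A + f1B)) + αA * τ1) ∧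
    (0 < f1B →
      1 / (c1 - (f1A + f1B)) + αB * τ1 ≤ 1 / (c2 - (f2A + f2B)) + αB * τ2) ∧
    (0 < f2B →
      1 / (c2 - (f2A + f2B)) + αB * τ2 ≤ 1 / (c1 - (f1A + f1B)) + αB * τ1) := by
  rw [Real.sqrt_mul hc1.le] at hDgt hτ2
  have hs : 0 < Real.sqrt c1 := Real.sqrt_pos.2 hc1
  have ht : 0 < Real.sqrt c2 := Real.sqrt_pos.2 (hc1.trans hc12)
  have hs2 : c1 = Real.sqrt c1 ^ 2 := (Real.sq_sqrt hc1.le).symm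
  have ht2 : c2 = Real.sqrt c2 ^ 2 := (Real.sq_sqrt (hc1.trans hc12).le).symm
  generalize Real.sqrt c1 = s at *
  generalize Real.sqrt c2 = t at *
  have hst : 0 < s + t := by linarith
  have hαA : 0 < αA := by linarith
  have hE : 0 < c1 + c2 - D := by linarith
  have hsum : fopt1 + fopt2 = D := by
    rw [hopt1, hopt2]; field_simp; ring
  have h1 : c1 - fopt1 = s * (c1 + c2 - D) / (s + t) := by
    rw [hopt1]; field_simp; ring
  have h2 : c2 - fopt2 = t * (c1 + c2 - D) / (s + t) := by
    rw [hopt2]; field_simp; ring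
  have hpos : 0 ≤ fopt1 := by
    rw [hopt1]
    apply div_nonneg _ hst.le
    have := mul_pos hs (show 0 < D - c2 + s * t by linarith)
    have e : c1 * t = s ^ 2 * t := by rw [← hs2]
    nlinarith
  have hτpos : 0 ≤ τ2 := by
    rw [hτ2]
    have : 0 < c2 - c1 := by linarith
    positivity
  have hA : 1 / (c1 - fopt1) = 1 / (c2 - fopt2) + αA * τ2 := by
    have hd : c2 - c1 = (t - s) * (s + t) := by rw [hs2, ht2]; ring
    rw [h1, h2, hτ2, hd]
    generalize c1 + c2 - D = E at *
    field_simp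
    ring
  have hB : αB * τ2 ≤ αA * τ2 := mul_le_mul_of_nonneg_right hαAB.le hτpos
  have e1 : f1A + f1B = fopt1 := by linarith
  have e2 : f2A + f2B = fopt2 := by linarith
  rw [e1, e2, hA, hτ1]
  refine ⟨⟨?_, ?_, ?_, ?_, ?_, ?_⟩, ⟨rfl, rfl⟩, ?_, ?_, ?_, ?_⟩ <;> intros <;> linarith
end

section
/- Let 0 < c1 < c2, αA > αB > 0, demands dA, dB > 0 with D = dA + dB satisfying c2 − √(c1·c2) < D < c1 + c2, and let f^opt_1 = ((D − c2)√c1 + c1√c2)/(√c1 + √c2), f^opt_2 = ((D − c1)√c2 + c2√c1)/(√c1 + √c2). Suppose dB > f^opt_2, and set τ1 = 0 and τ2 = (c2 − c1)/( αB·√(c1·c2)·(c1 + c2 − D) ). Then the class-decomposed flow defined by f_{2,A} = 0, f_{1,A} = dA, f_{1,B} = f^opt_1 − dA, f_{2,B} = f^opt_2 is well defined (all components nonnegative, satisfying the class demand constraints) and is a taxed Wardrop equilibrium whose aggregate flows are exactly (f^opt_1, f^opt_2). -/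
/-- When `dB > f^opt_2` and the tax `τ2 = (c2 - c1)/(αB √(c1 c2) (c1 + c2 - D))`
is applied to network 2 (with `τ1 = 0`), the class-decomposed flow
`f_{2,A} = 0`, `f_{1,A} = dA`, `f_{1,B} = f^opt_1 - dA`, `f_{2,B} = f^opt_2`
is well defined (all components nonnegative, satisfying the class demand
constraints) and is a taxed Wardrop equilibrium with aggregate flows
`(f^opt_1, f^opt_2)`. -/
theorem optimal_tax_equilibrium_exists_case_B
    (c1 c2 dA dB D αA αB τ1 τ2 fopt1 fopt2 : ℝ)
    (hc1 : 0 < c1) (hc12 : c1 < c2)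
    (hdA : 0 < dA) (hdB : 0 < dB) (hD : D = dA + dB)
    (hDgt : c2 - Real.sqrt (c1 * c2) < D) (hDlt : D < c1 + c2)
    (hαB : 0 < αB) (hαAB : αB < αA)
    (hopt1 : fopt1 = ((D - c2) * Real.sqrt c1 + c1 * Real.sqrt c2) / (Real.sqrt c1 + Real.sqrt c2))
    (hopt2 : fopt2 = ((D - c1) * Real.sqrt c2 + c2 * Real.sqrt c1) / (Real.sqrt c1 + Real.sqrt c2))
    (hdBgt : fopt2 < dB)
    (hτ1 : τ1 = 0)
    (hτ2 : τ2 = (c2 - c1) / (αB * Real.sqrt (c1 * c2) * (c1 + c2 - D)))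
    (f1A f2A f1B f2B : ℝ)
    (hf2A : f2A = 0) (hf1A : f1A = dA)
    (hf1B : f1B = fopt1 - dA) (hf2B : f2B = fopt2) :
    (0 ≤ f1A ∧ 0 ≤ f2A ∧ 0 ≤ f1B ∧ 0 ≤ f2B ∧
      f1A + f2A = dA ∧ f1B + f2B = dB) ∧
    (f1A + f1B = fopt1 ∧ f2A + f2B = fopt2) ∧
    (0 < f1A →
      1 / (c1 - (f1A + f1B)) + αA * τ1 ≤ 1 / (c2 - (f2A + f2B)) + αA * τ2) ∧
    (0 < f2A →
      1 / (c2 - (f2A + f2B)) + αA * τ2 ≤ 1 / (c1 - (f1A + f1B)) + αA * τ1) ∧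
    (0 < f1B →
      1 / (c1 - (f1A + f1B)) + αB * τ1 ≤ 1 / (c2 - (f2A + f2B)) + αB * τ2) ∧
    (0 < f2B →
      1 / (c2 - (f2A + f2B)) + αB * τ2 ≤ 1 / (c1 - (f1A + f1B)) + αB * τ1) := by
  obtain ⟨a, ha, rfl⟩ : ∃ a : ℝ, 0 < a ∧ c1 = a ^ 2 :=
    ⟨Real.sqrt c1, Real.sqrt_pos.2 hc1, (Real.sq_sqrt hc1.le).symm⟩
  have hc2 : 0 < c2 := hc1.trans hc12
  obtain ⟨b, hb, rfl⟩ : ∃ b : ℝ, 0 < b ∧ c2 = b ^ 2 :=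
    ⟨Real.sqrt c2, Real.sqrt_pos.2 hc2, (Real.sq_sqrt hc2.le).symm⟩
  have hab : Real.sqrt (a ^ 2 * b ^ 2) = a * b := by
    rw [← mul_pow, Real.sqrt_sq (mul_pos ha hb).le]
  rw [hab] at hDgt hτ2
  rw [Real.sqrt_sq ha.le, Real.sqrt_sq hb.le] at hopt1 hopt2
  have hR : 0 < a ^ 2 + b ^ 2 - D := by linarith
  have hs : 0 < a + b := by linarith
  have h1 : a ^ 2 - fopt1 = a * (a ^ 2 + b ^ 2 - D) / (a + b) := by
    rw [hopt1]; field_simp; ring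
  have h2 : b ^ 2 - fopt2 = b * (a ^ 2 + b ^ 2 - D) / (a + b) := by
    rw [hopt2]; field_simp; ring
  have hsum : fopt1 + fopt2 = D := by
    rw [hopt1, hopt2]; field_simp; ring
  have hf2 : 0 < fopt2 := by
    rw [hopt2]
    apply div_pos _ hs
    nlinarith [mul_pos (sub_pos.2 hDgt) hb, mul_pos (sub_pos.2 hc12) hb]
  have hτpos : 0 < τ2 := by
    rw [hτ2]
    exact div_pos (sub_pos.2 hc12) (mul_pos (mul_pos hαB (mul_pos ha hb)) hR)
  have key : 1 / (a ^ 2 - fopt1) = 1 / (b ^ 2 - fopt2) + αB * τ2 := by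
    rw [h1, h2, hτ2]
    generalize a ^ 2 + b ^ 2 - D = R at hR
    field_simp
    ring
  have e1 : f1A + f1B = fopt1 := by linarith
  have e2 : f2A + f2B = fopt2 := by linarith
  have hmul : αB * τ2 ≤ αA * τ2 := mul_le_mul_of_nonneg_right hαAB.le hτpos.le
  rw [e1, e2, key, hτ1]
  refine ⟨⟨by linarith, by linarith, by linarith, by linarith, by linarith, by linarith⟩,
    ⟨rfl, rfl⟩, fun _ => by linarith, fun h => by linarith, fun _ => by linarith,
    fun _ => by linarith⟩
end

section
/- Let 0 < c1 < c2 and 0 < D < c1 + c2, and let C^WE denote the total cost at the Wardrop equilibrium without taxes (C^WE = D/(c2 − D) if D ≤ c2 − c1, and 2D/(c1 + c2 − D) otherwise) and C^opt the minimum total cost (C^opt = D/(c2 − D) if D ≤ c2 − √(c1·c2), and (2D − c1 − c2 + 2√(c1·c2))/(c1 + c2 − D) otherwise). Then C^opt ≤ C^WE, with equality if and only if D ≤ c2 − √(c1·c2). -/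
/-- The minimum total cost never exceeds the equilibrium total cost,
`C^opt ≤ C^WE`, with equality if and only if `D ≤ c2 - √(c1 c2)`. -/
theorem optimal_cost_le_equilibrium_cost
    (c1 c2 D : ℝ) (hc1 : 0 < c1) (hc12 : c1 < c2)
    (hD : 0 < D) (hDlt : D < c1 + c2)
    (CWE Copt : ℝ)
    (hCWE : CWE = if D ≤ c2 - c1 then D / (c2 - D) else 2 * D / (c1 + c2 - D))
    (hCopt : Copt = if D ≤ c2 - Real.sqrt (c1 * c2) then D / (c2 - D)
      else (2 * D - c1 - c2 + 2 * Real.sqrt (c1 * c2)) / (c1 + c2 - D)) :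
    Copt ≤ CWE ∧ (Copt = CWE ↔ D ≤ c2 - Real.sqrt (c1 * c2)) := by
  obtain ⟨s, hs⟩ : ∃ s, s = Real.sqrt (c1 * c2) := ⟨_, rfl⟩
  have hs2 : s ^ 2 = c1 * c2 := by
    rw [hs]; exact Real.sq_sqrt (by nlinarith)
  have hs0 : 0 ≤ s := by rw [hs]; exact Real.sqrt_nonneg _
  rw [← hs] at hCopt ⊢
  have h1 : c1 < s := by
    by_contra h
    push Not at h
    nlinarith
  have hden : 0 < c1 + c2 - D := by linarith
  by_cases h : D ≤ c2 - s
  · have h' : D ≤ c2 - c1 := by linarith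
    rw [if_pos h] at hCopt
    rw [if_pos h'] at hCWE
    have e : Copt = CWE := by rw [hCopt, hCWE]
    exact ⟨e.le, fun _ => h, fun _ => e⟩
  · rw [if_neg h] at hCopt
    have hlt : Copt < CWE := by
      by_cases h' : D ≤ c2 - c1
      · rw [if_pos h'] at hCWE
        rw [hCopt, hCWE, div_lt_div_iff₀ hden (by linarith)]
        have : 0 < (s - (c2 - D)) ^ 2 := by
          apply pow_pos
          push Not at h
          linarith
        nlinarith
      · rw [if_neg h'] at hCWE
        rw [hCopt, hCWE]
        apply div_lt_div_of_pos_right _ hden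
        have : 0 < (c2 - c1) ^ 2 := pow_pos (by linarith) 2
        nlinarith
    exact ⟨hlt.le, fun e => absurd e hlt.ne, fun e => absurd e h⟩
end
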